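/- For nested embeddings Sym(ℓ) ⊂ Sym(m) ⊆ Sym(n) with n ≥ m > ℓ ≥ 3, the coset axis x = id_m - id_ℓ in A^α_3(Sym(n)) is a semisimple idempotent whose eigenvalues are contained in {1, 0, η(m), 1-η(ℓ), η(m)-η(ℓ)}, where η(j) = αj/(2+2α(j-2)). -/

import Mathlib

open Finset Equiv

section helpers

lemma ca_solve {A : Type*} [AddCommGroup A] [Module ℚ A] (L : Module.End ℚ A) (Λ : Set ℚ) (lam : ℚ)
    (hl : lam ∉ Λ) (w : A) (hw : w ∈ ⨆ μ ∈ Λ, Module.End.eigenspace L μ) :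
    ∃ w' ∈ ⨆ μ ∈ Λ, Module.End.eigenspace L μ, L w' - lam • w' = w := by
  have key : (⨆ μ ∈ Λ, Module.End.eigenspace L μ) ≤
      (⨆ μ ∈ Λ, Module.End.eigenspace L μ).map (L - lam • LinearMap.id) := by
    refine iSup₂_le fun μ hμ y hy => ?_
    have hne : μ - lam ≠ 0 := by
      intro h
      apply hl
      rw [← sub_eq_zero.mp h]
      exact hμ
    refine ⟨(μ - lam)⁻¹ • y, ?_, ?_⟩
    · apply Submodule.smul_mem
      exact (le_iSup₂ (f := fun μ (_ : μ ∈ Λ) => Module.End.eigenspace L μ) μ hμ) hy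
    · rw [Module.End.mem_eigenspace_iff] at hy
      simp only [LinearMap.sub_apply, LinearMap.smul_apply, LinearMap.id_apply, map_smul, hy]
      rw [← sub_smul, smul_smul, inv_mul_cancel₀ hne, one_smul]
  obtain ⟨w', h1, h2⟩ := key hw
  exact ⟨w', h1, by simpa using h2⟩

lemma ca_step {A : Type*} [AddCommGroup A] [Module ℚ A] (L : Module.End ℚ A) (Λ Λ' : Set ℚ) (lam : ℚ)
    (hl : lam ∉ Λ) (hsub : Λ ⊆ Λ') (hlam : lam ∈ Λ') (v w : A)
    (hw : w ∈ ⨆ μ ∈ Λ, Module.End.eigenspace L μ) (hv : L v = lam • v + w) :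
    v ∈ ⨆ μ ∈ Λ', Module.End.eigenspace L μ := by
  obtain ⟨w', h1, h2⟩ := ca_solve L Λ lam hl w hw
  have e1 : v - w' ∈ Module.End.eigenspace L lam := by
    rw [Module.End.mem_eigenspace_iff, map_sub, hv, ← h2, smul_sub]
    abel
  have e2 := (le_iSup₂ (f := fun μ (_ : μ ∈ Λ') => Module.End.eigenspace L μ) lam hlam) e1
  have e3 : w' ∈ ⨆ μ ∈ Λ', Module.End.eigenspace L μ :=
    (biSup_mono (f := fun μ => Module.End.eigenspace L μ) hsub) h1
  have := Submodule.add_mem _ e2 e3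
  simpa using this

lemma ca_mono {A : Type*} [AddCommGroup A] [Module ℚ A] (L : Module.End ℚ A) {Λ Λ' : Set ℚ}
    (hsub : Λ ⊆ Λ') {v : A} (h1 : v ∈ ⨆ μ ∈ Λ, Module.End.eigenspace L μ) :
    v ∈ ⨆ μ ∈ Λ', Module.End.eigenspace L μ :=
  (biSup_mono (f := fun μ => Module.End.eigenspace L μ) hsub) h1

lemma ca_eig {A : Type*} [AddCommGroup A] [Module ℚ A] (L : Module.End ℚ A) {Λ : Set ℚ} {lam : ℚ}
    (hlam : lam ∈ Λ) {v : A} (h : L v = lam • v) :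
    v ∈ ⨆ μ ∈ Λ, Module.End.eigenspace L μ :=
  (le_iSup₂ (f := fun μ (_ : μ ∈ Λ) => Module.End.eigenspace L μ) lam hlam)
    (Module.End.mem_eigenspace_iff.mpr h)

lemma ca_contain {A : Type*} [AddCommGroup A] [Module ℚ A] (L : Module.End ℚ A) (Λ : Set ℚ)
    (htop : (⨆ μ ∈ Λ, Module.End.eigenspace L μ) = ⊤) (μ : ℚ)
    (h : Module.End.eigenspace L μ ≠ ⊥) : μ ∈ Λ := by
  by_contra hμ
  apply h
  have := Module.End.eigenspaces_iSupIndep L μ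
  have h2 : (⨆ ν ∈ Λ, Module.End.eigenspace L ν) ≤
      ⨆ ν, ⨆ (_ : ν ≠ μ), Module.End.eigenspace L ν := by
    refine iSup₂_le fun ν hν => ?_
    refine le_iSup₂ (f := fun ν (_ : ν ≠ μ) => Module.End.eigenspace L ν) ν ?_
    rintro rfl
    exact hμ hν
  rw [htop, top_le_iff] at h2
  rw [h2] at this
  exact disjoint_top.mp this

/-- action of the double sum, mixed case -/
lemma ca_mid {ι A : Type*} [DecidableEq ι] [NonUnitalNonAssocCommRing A]
    [Module ℚ A] [SMulCommClass ℚ A A] [IsScalarTower ℚ A A]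
    (α : ℚ) (t : ι → ι → A) (t0 : ∀ a, t a a = 0) (ts : ∀ a b, t a b = t b a)
    (td : ∀ a b c d, a ≠ c → a ≠ d → b ≠ c → b ≠ d → t a b * t c d = 0)
    (tn : ∀ a b c, a ≠ b → a ≠ c → b ≠ c → t a c * t a b = (α/2) • (t a c + t a b - t c b))
    (S : Finset ι) (a b : ι) (ha : a ∈ S) (hb : b ∉ S) :
    (∑ c ∈ S, ∑ d ∈ S, t c d) * t a b =
      α • (∑ e ∈ S, t a e + (S.card : ℚ) • t a b - ∑ e ∈ S, t e b) := by
  have hab : a ≠ b := by rintro rfl; exact hb ha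
  have pw : ∀ c ∈ S, ∀ d ∈ S, t c d * t a b =
      (if c = a then (α/2) • (t a d + t a b - t d b) else 0) +
      (if d = a then (α/2) • (t a c + t a b - t c b) else 0) := by
    intro c hc d hd
    have hcb : c ≠ b := by rintro rfl; exact hb hc
    have hdb : d ≠ b := by rintro rfl; exact hb hd
    by_cases h1 : c = a
    · subst h1
      by_cases h2 : d = c
      · subst h2; simp [t0]
      · rw [tn _ _ _ hab (Ne.symm h2) (Ne.symm hdb)]; simp [h2]
    · by_cases h2 : d = a
      · subst h2
        rw [ts c d, tn _ _ _ hab (Ne.symm h1) (Ne.symm hcb)]; simp [h1]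
      · rw [td c d a b h1 hcb h2 hdb]; simp [h1, h2]
  rw [Finset.sum_mul]
  simp_rw [Finset.sum_mul]
  rw [Finset.sum_congr rfl fun c hc => Finset.sum_congr rfl fun d hd => pw c hc d hd]
  simp_rw [Finset.sum_add_distrib]
  rw [Finset.sum_comm]
  simp only [Finset.sum_ite_eq', ha, if_true]
  rw [← Finset.smul_sum, Finset.sum_sub_distrib, Finset.sum_add_distrib, Finset.sum_const,
    ← Nat.cast_smul_eq_nsmul ℚ]
  module

lemma ca_in {ι A : Type*} [DecidableEq ι] [NonUnitalNonAssocCommRing A]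
    [Module ℚ A] [SMulCommClass ℚ A A] [IsScalarTower ℚ A A]
    (α : ℚ) (t : ι → ι → A) (t0 : ∀ a, t a a = 0) (ts : ∀ a b, t a b = t b a)
    (ti : ∀ a b, t a b * t a b = t a b)
    (td : ∀ a b c d, a ≠ c → a ≠ d → b ≠ c → b ≠ d → t a b * t c d = 0)
    (tn : ∀ a b c, a ≠ b → a ≠ c → b ≠ c → t a c * t a b = (α/2) • (t a c + t a b - t c b))
    (S : Finset ι) (a b : ι) (ha : a ∈ S) (hb : b ∈ S) :
    (∑ c ∈ S, ∑ d ∈ S, t c d) * t a b =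
      (2 * (1 + α * ((S.card : ℚ) - 2))) • t a b := by
  by_cases hab : a = b
  · subst hab; simp [t0]
  have hba : b ≠ a := Ne.symm hab
  have pw : ∀ c ∈ S, ∀ d ∈ S, t c d * t a b =
      (if c = a then (α/2) • (t a d + t a b - t d b) else 0) +
      (if d = a then (α/2) • (t a c + t a b - t c b) else 0) +
      (if c = b then (α/2) • (t b d + t a b - t d a) else 0) +
      (if d = b then (α/2) • (t b c + t a b - t c a) else 0) +
      (if c = a then if d = b then (1 - 2 * α) • t a b else 0 else 0) +
      (if c = b then if d = a then (1 - 2 * α) • t a b else 0 else 0) := by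
    intro c hc d hd
    by_cases h1 : c = a
    · subst h1
      by_cases h2 : d = c
      · subst h2; simp [t0, hab]
      · by_cases h3 : d = b
        · subst h3
          simp only [ti, hab, hba, if_true, if_false, t0, ts d c]
          module
        · rw [tn _ _ _ hab (Ne.symm h2) (Ne.symm h3)]; simp [h2, h3, hab]
    · by_cases h2 : d = a
      · subst h2
        by_cases h3 : c = b
        · subst h3
          rw [ts c d]
          simp only [ti, hab, hba, if_true, if_false, t0]
          module
        · rw [ts c d, tn _ _ _ hab (Ne.symm h1) (Ne.symm h3)]; simp [h1, h3, hab]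
      · by_cases h3 : c = b
        · subst h3
          by_cases h4 : d = c
          · subst h4; simp [t0, hba, ts a d]
          · rw [ts a c, tn _ _ _ hba (Ne.symm h4) (Ne.symm h2)]; simp [h2, h4, hba]
        · by_cases h4 : d = b
          · subst h4
            rw [ts a d, ts c d, tn _ _ _ hba (Ne.symm h3) (Ne.symm h1)]; simp [h1, h3, hba]
          · rw [td c d a b h1 h3 h2 h4]; simp [h1, h2, h3, h4]
  rw [Finset.sum_mul]
  simp_rw [Finset.sum_mul]
  rw [Finset.sum_congr rfl fun c hc => Finset.sum_congr rfl fun d hd => pw c hc d hd]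
  simp only [Finset.sum_add_distrib, Finset.sum_ite_irrel, Finset.sum_const_zero,
    Finset.sum_ite_eq', ha, hb, if_true]
  simp only [← Finset.smul_sum, Finset.sum_sub_distrib, Finset.sum_add_distrib, Finset.sum_const,
    ← Nat.cast_smul_eq_nsmul ℚ]
  rw [Finset.sum_congr rfl fun c _ => ts c a, Finset.sum_congr rfl fun c _ => ts c b]
  module

lemma ca_out {ι A : Type*} [DecidableEq ι] [NonUnitalNonAssocCommRing A]
    (t : ι → ι → A)
    (td : ∀ a b c d, a ≠ c → a ≠ d → b ≠ c → b ≠ d → t a b * t c d = 0)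
    (S : Finset ι) (a b : ι) (ha : a ∉ S) (hb : b ∉ S) :
    (∑ c ∈ S, ∑ d ∈ S, t c d) * t a b = 0 := by
  rw [Finset.sum_mul]
  refine Finset.sum_eq_zero fun c hc => ?_
  rw [Finset.sum_mul]
  refine Finset.sum_eq_zero fun d hd => ?_
  apply td
  all_goals (rintro rfl; contradiction)

lemma ca_core {ι A : Type*} [DecidableEq ι] [NonUnitalNonAssocCommRing A]
    [Module ℚ A] [SMulCommClass ℚ A A] [IsScalarTower ℚ A A]
    (α : ℚ) (t : ι → ι → A) (ts : ∀ a b, t a b = t b a)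
    (P Q : Finset ι) (hPQ : P ⊆ Q) (u v x : A) (bm bl em el gm gl : ℚ) (hx : x = u - v)
    (hem : em = bm * Q.card) (hel : el = bl * P.card)
    (hu : u = gm • ∑ c ∈ Q, ∑ d ∈ Q, t c d) (hv : v = gl • ∑ c ∈ P, ∑ d ∈ P, t c d)
    (hgm : bm = α * gm) (hgl : bl = α * gl)
    (u_in : ∀ a ∈ Q, ∀ b ∈ Q, u * t a b = t a b)
    (u_mid : ∀ a ∈ Q, ∀ b ∉ Q, u * t a b =
      bm • (∑ e ∈ Q, t a e + (Q.card : ℚ) • t a b - ∑ e ∈ Q, t e b))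
    (u_out : ∀ a ∉ Q, ∀ b ∉ Q, u * t a b = 0)
    (v_in : ∀ a ∈ P, ∀ b ∈ P, v * t a b = t a b)
    (v_mid : ∀ a ∈ P, ∀ b ∉ P, v * t a b =
      bl • (∑ e ∈ P, t a e + (P.card : ℚ) • t a b - ∑ e ∈ P, t e b))
    (v_out : ∀ a ∉ P, ∀ b ∉ P, v * t a b = 0)
    (hdist : ({1, 0, em, 1 - el, em - el} : Finset ℚ).card = 5) :
    x * x = x ∧ ∀ a b, t a b ∈ ⨆ μ ∈ ({1, 0, em, 1 - el, em - el} : Set ℚ),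
        Module.End.eigenspace (LinearMap.mulLeft ℚ x) μ := by
  have uu : u * u = u := by
    conv_lhs => rw [hu]
    rw [← hu, hu, mul_smul_comm, ← hu, Finset.mul_sum]
    conv_rhs => rw [hu]
    congr 1
    refine Finset.sum_congr rfl fun c hc => ?_
    rw [Finset.mul_sum]
    exact Finset.sum_congr rfl fun d hd => u_in c hc d hd
  have vv : v * v = v := by
    conv_lhs => rw [hv]
    rw [← hv, hv, mul_smul_comm, ← hv, Finset.mul_sum]
    conv_rhs => rw [hv]
    congr 1
    refine Finset.sum_congr rfl fun c hc => ?_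
    rw [Finset.mul_sum]
    exact Finset.sum_congr rfl fun d hd => v_in c hc d hd
  have uv : u * v = v := by
    rw [hv, mul_smul_comm, Finset.mul_sum]
    congr 1
    refine Finset.sum_congr rfl fun c hc => ?_
    rw [Finset.mul_sum]
    exact Finset.sum_congr rfl fun d hd => u_in c (hPQ hc) d (hPQ hd)
  have xx : x * x = x := by
    rw [hx, sub_mul, mul_sub, mul_sub, mul_comm v u, uu, vv, uv]; abel
  refine ⟨xx, ?_⟩
  have hd : (1:ℚ) ≠ 0 ∧ em ≠ 0 ∧ em ≠ 1 ∧ 1 - el ≠ 0 ∧ 1 - el ≠ 1 ∧ 1 - el ≠ em ∧ em - el ≠ 0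
      ∧ em - el ≠ 1 ∧ em - el ≠ em ∧ em - el ≠ 1 - el := by
    refine ⟨?_, ?_, ?_, ?_, ?_, ?_, ?_, ?_, ?_, ?_⟩ <;>
    · intro h
      have h4 : ∀ a b c d : ℚ, ({a, b, c, d} : Finset ℚ).card ≤ 4 := fun a b c d =>
        Finset.card_le_four
      have : ∃ a b c d : ℚ, ({1, 0, em, 1 - el, em - el} : Finset ℚ) ⊆ {a, b, c, d} := by
        first
        | exact absurd h one_ne_zero
        | refine ⟨1, 0, 1 - el, em - el, ?_⟩
          intro y hy
          simp only [Finset.mem_insert, Finset.mem_singleton] at hy ⊢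
          grind
        | refine ⟨1, 0, em, em - el, ?_⟩
          intro y hy
          simp only [Finset.mem_insert, Finset.mem_singleton] at hy ⊢
          grind
        | refine ⟨1, 0, em, 1 - el, ?_⟩
          intro y hy
          simp only [Finset.mem_insert, Finset.mem_singleton] at hy ⊢
          grind
      obtain ⟨a, b, c, d, hs⟩ := this
      have := Finset.card_le_card hs
      have := h4 a b c d
      omega
  obtain ⟨-, d1, d2, d3, d4, d5, d6, d7, d8, d9⟩ := hd
  set L := LinearMap.mulLeft ℚ x with hL
  have La : ∀ y, L y = u * y - v * y := fun y => by
    rw [hL, LinearMap.mulLeft_apply, hx, sub_mul]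
  -- A_P
  have c1 : ∀ a ∈ P, ∀ b ∈ P, t a b ∈ ⨆ μ ∈ ({0} : Set ℚ), Module.End.eigenspace L μ := by
    intro a ha b hb
    refine ca_eig L (lam := 0) (by simp) ?_
    rw [La, u_in a (hPQ ha) b (hPQ hb), v_in a ha b hb]; simp
  have vmem : v ∈ ⨆ μ ∈ ({0} : Set ℚ), Module.End.eigenspace L μ := by
    rw [hv]
    exact Submodule.smul_mem _ _ (Submodule.sum_mem _ fun c hc => Submodule.sum_mem _ fun d hd =>
      c1 c hc d hd)
  have vsP : ∀ b ∉ P, v * (∑ e ∈ P, t e b) = α • v := by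
    intro b hb
    rw [Finset.mul_sum, Finset.sum_congr rfl fun e he => v_mid e he b hb, ← Finset.smul_sum,
      Finset.sum_sub_distrib, Finset.sum_add_distrib, ← Finset.smul_sum, Finset.sum_const,
      ← Nat.cast_smul_eq_nsmul ℚ, hgl, hv]
    module
  have usQ : ∀ b ∉ Q, u * (∑ e ∈ Q, t e b) = α • u := by
    intro b hb
    rw [Finset.mul_sum, Finset.sum_congr rfl fun e he => u_mid e he b hb, ← Finset.smul_sum,
      Finset.sum_sub_distrib, Finset.sum_add_distrib, ← Finset.smul_sum, Finset.sum_const,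
      ← Nat.cast_smul_eq_nsmul ℚ, hgm, hu]
    module
  have vsQ : ∀ b ∉ Q, v * (∑ e ∈ Q, t e b) = α • v := by
    intro b hb
    have hb' : b ∉ P := fun h => hb (hPQ h)
    rw [← Finset.sum_sdiff hPQ, mul_add, vsP b hb', Finset.mul_sum, Finset.sum_eq_zero, zero_add]
    intro e he
    exact v_out e (Finset.mem_sdiff.mp he).2 b hb'
  have sP : ∀ b ∈ Q, b ∉ P → (∑ e ∈ P, t e b) ∈
      ⨆ μ ∈ ({0, 1} : Set ℚ), Module.End.eigenspace L μ := by
    intro b hb hb'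
    refine ca_step L {0} _ 1 (by simp) (by simp) (by simp) _ (-(α • v))
      (Submodule.neg_mem _ (Submodule.smul_mem _ _ vmem)) ?_
    rw [La, vsP b hb', Finset.mul_sum, Finset.sum_congr rfl fun e he => u_in e (hPQ he) b hb]
    module
  have c2 : ∀ a ∈ P, ∀ b ∈ Q, b ∉ P → t a b ∈
      ⨆ μ ∈ ({0, 1, 1 - el} : Set ℚ), Module.End.eigenspace L μ := by
    intro a ha b hb hb'
    refine ca_step L {0, 1} _ (1 - el) (by simp [d3, d4]) (by grind) (by simp) _
      ((-bl) • (∑ e ∈ P, t a e) + bl • ∑ e ∈ P, t e b) ?_ ?_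
    · refine Submodule.add_mem _ (Submodule.smul_mem _ _ ?_) (Submodule.smul_mem _ _ (sP b hb hb'))
      exact Submodule.sum_mem _ fun e he => ca_mono L (by simp) (c1 a ha e he)
    · rw [La, u_in a (hPQ ha) b hb, v_mid a ha b hb', hel]
      module
  have cQ : ∀ a ∈ Q, ∀ b ∈ Q, t a b ∈
      ⨆ μ ∈ ({0, 1, 1 - el} : Set ℚ), Module.End.eigenspace L μ := by
    intro a ha b hb
    by_cases ha' : a ∈ P
    · by_cases hb' : b ∈ P
      · exact ca_mono L (by simp) (c1 a ha' b hb')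
      · exact c2 a ha' b hb hb'
    · by_cases hb' : b ∈ P
      · rw [ts]; exact c2 b hb' a ha ha'
      · refine ca_eig L (lam := 1) (by simp) ?_
        rw [La, u_in a ha b hb, v_out a ha' b hb']; simp
  have sQ : ∀ b ∉ Q, (∑ e ∈ Q, t e b) ∈
      ⨆ μ ∈ ({0, 1, 1 - el} : Set ℚ), Module.End.eigenspace L μ := by
    intro b hb
    refine ca_step L {1} _ 0 (by simp) (by simp) (by simp) _ (α • x)
      (Submodule.smul_mem _ _ (ca_eig L (lam := 1) (by simp) ?_)) ?_
    · rw [hL, LinearMap.mulLeft_apply, xx, one_smul]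
    · rw [La, usQ b hb, vsQ b hb, hx]; module
  have sPb : ∀ b ∉ Q, (∑ e ∈ P, t e b) ∈
      ⨆ μ ∈ ({0, 1, 1 - el, em} : Set ℚ), Module.End.eigenspace L μ := by
    intro b hb
    refine ca_step L {0, 1, 1 - el} _ em (by simp [d1, d2, d5.symm]) (by grind) (by simp) _
      (bm • (∑ a ∈ P, ∑ e ∈ Q, t a e) - (bm * P.card) • (∑ e ∈ Q, t e b) - α • v) ?_ ?_
    · refine Submodule.sub_mem _ (Submodule.sub_mem _ (Submodule.smul_mem _ _ ?_)
        (Submodule.smul_mem _ _ (sQ b hb))) (Submodule.smul_mem _ _ (ca_mono L (by simp) vmem))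
      exact Submodule.sum_mem _ fun a ha => Submodule.sum_mem _ fun e he => cQ a (hPQ ha) e he
    · rw [La, vsP b (fun h => hb (hPQ h)), Finset.mul_sum,
        Finset.sum_congr rfl fun e he => u_mid e (hPQ he) b hb, ← Finset.smul_sum,
        Finset.sum_sub_distrib, Finset.sum_add_distrib, ← Finset.smul_sum, Finset.sum_const,
        ← Nat.cast_smul_eq_nsmul ℚ, hem]
      module
  have cM : ∀ a ∈ Q, ∀ b ∉ Q, t a b ∈ ⨆ μ ∈ ({1, 0, em, 1 - el, em - el} : Set ℚ),
        Module.End.eigenspace L μ := by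
    intro a ha b hb
    have hb' : b ∉ P := fun h => hb (hPQ h)
    by_cases ha' : a ∈ P
    · refine ca_step L {0, 1, 1 - el, em} _ (em - el) (by simp [d6, d7, d8, d9]) (by grind)
        (by simp) _
        (bm • (∑ e ∈ Q, t a e) - bl • (∑ e ∈ P, t a e) + bl • (∑ e ∈ P, t e b)
          - bm • ∑ e ∈ Q, t e b) ?_ ?_
      · refine Submodule.sub_mem _ (Submodule.add_mem _ (Submodule.sub_mem _
          (Submodule.smul_mem _ _ ?_) (Submodule.smul_mem _ _ ?_))
          (Submodule.smul_mem _ _ (sPb b hb)))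
          (Submodule.smul_mem _ _ (ca_mono L (by grind) (sQ b hb)))
        · exact Submodule.sum_mem _ fun e he => ca_mono L (by grind) (cQ a ha e he)
        · exact Submodule.sum_mem _ fun e he => ca_mono L (by grind) (cQ a ha e (hPQ he))
      · rw [La, u_mid a ha b hb, v_mid a ha' b hb', hem, hel]
        module
    · refine ca_step L {0, 1, 1 - el} _ em (by simp [d1, d2, d5.symm]) (by grind) (by simp) _
        (bm • (∑ e ∈ Q, t a e) - bm • ∑ e ∈ Q, t e b) ?_ ?_
      · refine Submodule.sub_mem _ (Submodule.smul_mem _ _ ?_) (Submodule.smul_mem _ _ (sQ b hb))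
        exact Submodule.sum_mem _ fun e he => cQ a ha e he
      · rw [La, u_mid a ha b hb, v_out a ha' b hb', hem]
        module
  intro a b
  by_cases ha : a ∈ Q
  · by_cases hb : b ∈ Q
    · exact ca_mono L (by grind) (cQ a ha b hb)
    · exact cM a ha b hb
  · by_cases hb : b ∈ Q
    · rw [ts]; exact cM b hb a ha
    · refine ca_eig L (lam := 0) (by simp) ?_
      rw [La, u_out a ha b hb, v_out a (fun h => ha (hPQ h)) b (fun h => hb (hPQ h))]; simp

open scoped Classical in
lemma ca_sum {n : ℕ} {A : Type*} [AddCommGroup A] (ρ : Perm (Fin n) → A) (k : ℕ) :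
    ∑ c ∈ univ.filter (fun i : Fin n => (i : ℕ) < k), ∑ d ∈ univ.filter (fun i : Fin n => (i : ℕ) < k),
      (if c = d then 0 else ρ (swap c d)) =
    2 • ∑ e ∈ univ.filter (fun g : Perm (Fin n) =>
      g.IsSwap ∧ ∀ x : Fin n, k ≤ (x : ℕ) → g x = x), ρ e := by
  set S := univ.filter (fun i : Fin n => (i : ℕ) < k) with hS
  rw [← Finset.sum_product' (f := fun c d => if c = d then (0 : A) else ρ (swap c d))]
  have h1 : ∑ p ∈ S ×ˢ S, (if p.1 = p.2 then (0 : A) else ρ (swap p.1 p.2)) =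
      ∑ p ∈ (S ×ˢ S).filter (fun p => p.1 ≠ p.2), ρ (swap p.1 p.2) := by
    rw [Finset.sum_filter]
    refine Finset.sum_congr rfl fun p _ => ?_
    by_cases h : p.1 = p.2 <;> simp [h]
  rw [h1]
  have h2 : ∀ p ∈ (S ×ˢ S).filter (fun p => p.1 ≠ p.2), swap p.1 p.2 ∈
      univ.filter (fun g : Perm (Fin n) =>
      g.IsSwap ∧ ∀ x : Fin n, k ≤ (x : ℕ) → g x = x) := by
    intro p hp
    simp only [hS, mem_filter, mem_product, mem_univ, true_and] at hp ⊢
    refine ⟨⟨p.1, p.2, hp.2, rfl⟩, fun x hx => swap_apply_of_ne_of_ne ?_ ?_⟩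
    · rintro rfl; omega
    · rintro rfl; omega
  rw [← Finset.sum_fiberwise_of_maps_to h2, Finset.smul_sum]
  refine Finset.sum_congr rfl fun e he => ?_
  rw [Finset.sum_congr rfl (g := fun _ => ρ e)
    (fun p hp => by rw [(Finset.mem_filter.mp hp).2]), Finset.sum_const]
  congr 1
  simp only [mem_filter, mem_univ, true_and] at he
  obtain ⟨⟨a, b, hab, rfl⟩, hfix⟩ := he
  rw [Finset.card_eq_two]
  have ha : (a : ℕ) < k := by
    by_contra h
    have := hfix a (by omega)
    rw [swap_apply_left] at this
    exact hab this.symm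
  have hb : (b : ℕ) < k := by
    by_contra h
    have := hfix b (by omega)
    rw [swap_apply_right] at this
    exact hab this
  refine ⟨(a, b), (b, a), by simp [hab], ?_⟩
  ext ⟨c, d⟩
  simp only [hS, mem_filter, mem_product, mem_univ, true_and, mem_insert, mem_singleton,
    Prod.mk.injEq]
  constructor
  · rintro ⟨⟨_, hcd⟩, h⟩
    have h3 := congrArg (fun f => f c) h
    have h4 := congrArg (fun f => f d) h
    simp only [swap_apply_left, swap_apply_right, swap_apply_def] at h3 h4
    grind
  · rintro (⟨rfl, rfl⟩ | ⟨rfl, rfl⟩)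
    · exact ⟨⟨⟨ha, hb⟩, hab⟩, rfl⟩
    · exact ⟨⟨⟨hb, ha⟩, hab.symm⟩, swap_comm _ _⟩

end helpers

open scoped Classical in
/-- for nested `Sym(ℓ) ⊂ Sym(m) ⊆ Sym(n)` with `n ≥ m > ℓ ≥ 3`, the coset
axis `x = id_m - id_ℓ` in `A^α_3(Sym(n))` is a semisimple idempotent whose eigenvalues
lie in `{1, 0, η(m), 1-η(ℓ), η(m)-η(ℓ)}`, where `η(j) = αj/(2+2α(j-2))`. -/
theorem coset_axis_eigenvalues
    {A : Type*} [NonUnitalNonAssocCommRing A]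
    [Module ℚ A] [SMulCommClass ℚ A A] [IsScalarTower ℚ A A]
    (n m ℓ : ℕ) (hl3 : 3 ≤ ℓ) (hlm : ℓ < m) (hmn : m ≤ n)
    (α : ℚ) (hα0 : α ≠ 0) (hα1 : α ≠ 1) (ρ : Equiv.Perm (Fin n) → A)
    (hmul_self : ∀ d : Perm (Fin n), d.IsSwap → ρ d * ρ d = ρ d)
    (hmul_comm : ∀ c d : Perm (Fin n), c.IsSwap → d.IsSwap → c ≠ d → Commute c d →
      ρ c * ρ d = 0)
    (hmul_ncomm : ∀ c d : Perm (Fin n), c.IsSwap → d.IsSwap → ¬ Commute c d →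
      ρ c * ρ d = (α/2) • (ρ c + ρ d - ρ (d⁻¹ * c * d)))
    (hspan : Submodule.span ℚ (ρ '' {g : Perm (Fin n) | g.IsSwap}) = ⊤)
    (hindep : LinearIndependent ℚ (fun d : {g : Perm (Fin n) // g.IsSwap} => ρ d.1))
    (η : ℕ → ℚ) (hη : ∀ j : ℕ, η j = α * j / (2 + 2 * α * ((j : ℚ) - 2)))
    (hdenm : 1 + α * ((m : ℚ) - 2) ≠ 0) (hdenl : 1 + α * ((ℓ : ℚ) - 2) ≠ 0)
    (hdistinct : ({1, 0, η m, 1 - η ℓ, η m - η ℓ} : Finset ℚ).card = 5)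
    (Em El : Finset (Perm (Fin n)))
    (hEm : Em = univ.filter fun g : Perm (Fin n) =>
      g.IsSwap ∧ ∀ x : Fin n, m ≤ (x : ℕ) → g x = x)
    (hEl : El = univ.filter fun g : Perm (Fin n) =>
      g.IsSwap ∧ ∀ x : Fin n, ℓ ≤ (x : ℕ) → g x = x)
    (x : A)
    (hx : x = (1 + α * ((m : ℚ) - 2))⁻¹ • ∑ e ∈ Em, ρ e
            - (1 + α * ((ℓ : ℚ) - 2))⁻¹ • ∑ e ∈ El, ρ e) :
    x * x = x ∧
    (∀ μ : ℚ, Module.End.eigenspace (LinearMap.mulLeft ℚ x) μ ≠ ⊥ →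
        μ ∈ ({1, 0, η m, 1 - η ℓ, η m - η ℓ} : Set ℚ)) ∧
    (⨆ μ ∈ ({1, 0, η m, 1 - η ℓ, η m - η ℓ} : Set ℚ),
        Module.End.eigenspace (LinearMap.mulLeft ℚ x) μ) = ⊤ := by
  set t : Fin n → Fin n → A := fun a b => if a = b then 0 else ρ (swap a b) with ht
  have sw : ∀ a b : Fin n, a ≠ b → (swap a b).IsSwap := fun a b h => ⟨a, b, h, rfl⟩
  have t0 : ∀ a, t a a = 0 := fun a => by simp [ht]
  have ts : ∀ a b, t a b = t b a := fun a b => by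
    simp only [ht, swap_comm a b, eq_comm (a := a) (b := b)]
  have ti : ∀ a b, t a b * t a b = t a b := by
    intro a b
    by_cases h : a = b
    · simp [ht, h]
    · simp only [ht, h, if_false]
      exact hmul_self _ (sw a b h)
  have td : ∀ a b c d, a ≠ c → a ≠ d → b ≠ c → b ≠ d → t a b * t c d = 0 := by
    intro a b c d h1 h2 h3 h4
    by_cases hab : a = b
    · simp [ht, hab]
    by_cases hcd : c = d
    · simp [ht, hcd]
    simp only [ht, hab, hcd, if_false]
    refine hmul_comm _ _ (sw a b hab) (sw c d hcd) ?_ ?_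
    · intro h
      have := congrArg (fun f => f a) h
      simp only [swap_apply_left, swap_apply_of_ne_of_ne h1 h2] at this
      exact hab this.symm
    · ext y
      simp only [Perm.mul_apply, swap_apply_def]
      grind
  have tn : ∀ a b c, a ≠ b → a ≠ c → b ≠ c →
      t a c * t a b = (α/2) • (t a c + t a b - t c b) := by
    intro a b c h1 h2 h3
    simp only [ht, h1, h2, h3.symm, if_false]
    rw [hmul_ncomm _ _ (sw a c h2) (sw a b h1)]
    · congr 3
      ext y
      simp only [Perm.mul_apply, swap_inv, swap_apply_def]
      grind
    · intro h
      have := congrArg (fun f => f a) h.eq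
      simp only [Perm.mul_apply, swap_apply_left, swap_apply_of_ne_of_ne h1.symm h3,
        swap_apply_of_ne_of_ne h2.symm h3.symm] at this
      exact h3 this
  have cardS : ∀ k ≤ n, (univ.filter (fun i : Fin n => (i : ℕ) < k)).card = k := by
    intro k hk
    rw [Fin.card_filter_val_lt]
    exact min_eq_right hk
  have hP := cardS ℓ (by omega)
  have hQ := cardS m hmn
  have sumP := ca_sum ρ ℓ
  have sumQ := ca_sum ρ m
  rw [← hEl] at sumP
  rw [← hEm] at sumQ
  set P := univ.filter (fun i : Fin n => (i : ℕ) < ℓ) with hPdef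
  set Q := univ.filter (fun i : Fin n => (i : ℕ) < m) with hQdef
  change ∑ c ∈ P, ∑ d ∈ P, t c d = _ at sumP
  change ∑ c ∈ Q, ∑ d ∈ Q, t c d = _ at sumQ
  rw [← Nat.cast_smul_eq_nsmul ℚ] at sumP sumQ
  have hu : (1 + α * ((m : ℚ) - 2))⁻¹ • ∑ e ∈ Em, ρ e =
      (2 * (1 + α * ((m : ℚ) - 2)))⁻¹ • ∑ c ∈ Q, ∑ d ∈ Q, t c d := by
    rw [sumQ, smul_smul]; congr 1; push_cast; field_simp
  have hv : (1 + α * ((ℓ : ℚ) - 2))⁻¹ • ∑ e ∈ El, ρ e =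
      (2 * (1 + α * ((ℓ : ℚ) - 2)))⁻¹ • ∑ c ∈ P, ∑ d ∈ P, t c d := by
    rw [sumP, smul_smul]; congr 1; push_cast; field_simp
  have hPQ : P ⊆ Q := by
    intro i hi
    simp only [hPdef, hQdef, mem_filter, mem_univ, true_and] at hi ⊢
    omega
  have key := ca_core α t ts P Q hPQ _ _ x (α * (2 * (1 + α * ((m : ℚ) - 2)))⁻¹)
    (α * (2 * (1 + α * ((ℓ : ℚ) - 2)))⁻¹) (η m) (η ℓ) _ _ hx
    (by rw [hη, hQ, div_eq_mul_inv]; ring_nf) (by rw [hη, hP, div_eq_mul_inv]; ring_nf)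
    hu hv rfl rfl
    (by
      intro a ha b hb
      rw [hu, smul_mul_assoc, ca_in α t t0 ts ti td tn Q a b ha hb, hQ, smul_smul,
        inv_mul_cancel₀ (mul_ne_zero two_ne_zero hdenm), one_smul])
    (by
      intro a ha b hb
      rw [hu, smul_mul_assoc, ca_mid α t t0 ts td tn Q a b ha hb, smul_smul, mul_comm _ α])
    (by
      intro a ha b hb
      rw [hu, smul_mul_assoc, ca_out t td Q a b ha hb, smul_zero])
    (by
      intro a ha b hb
      rw [hv, smul_mul_assoc, ca_in α t t0 ts ti td tn P a b ha hb, hP, smul_smul,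
        inv_mul_cancel₀ (mul_ne_zero two_ne_zero hdenl), one_smul])
    (by
      intro a ha b hb
      rw [hv, smul_mul_assoc, ca_mid α t t0 ts td tn P a b ha hb, smul_smul, mul_comm _ α])
    (by
      intro a ha b hb
      rw [hv, smul_mul_assoc, ca_out t td P a b ha hb, smul_zero])
    (by convert hdistinct)
  obtain ⟨xx, hmem⟩ := key
  have htop : (⨆ μ ∈ ({1, 0, η m, 1 - η ℓ, η m - η ℓ} : Set ℚ),
        Module.End.eigenspace (LinearMap.mulLeft ℚ x) μ) = ⊤ := by
    rw [eq_top_iff, ← hspan, Submodule.span_le]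
    rintro _ ⟨g, ⟨a, b, hab, rfl⟩, rfl⟩
    have := hmem a b
    simp only [ht, hab, if_false] at this
    exact this
  exact ⟨xx, fun μ hμ => ca_contain _ _ htop μ hμ, htop⟩
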